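/- arXiv:1907.08016 — 2 statements merged into one kernel-verified Lean document; each statement's English description precedes it below -/
import Mathlib

section
/- Let r, s ≥ 1 be integers and α = [0; a₁, …, a_r, overline{a_{r+1}, …, a_{r+s}}] ∈ F_q((T⁻¹)) be an ultimately periodic continued fraction with a_r ≠ a_{r+s}, and suppose α is separable quadratic with Galois conjugate α′ ≠ α. Then min(|a_r|, |a_{r+s}|)/|q_r|² ≤ |α − α′| ≤ |a_r · a_{r+s}|/|q_r|², where q_r is the r-th convergent denominator. -/
open Polynomial
open scoped Classical

noncomputable section

namespace CFq

variable (Fq : Type) [Field Fq] [Fintype Fq]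

/-- The element `T` of `F_q((T⁻¹))`, realized as `X⁻¹` in the Laurent series field. -/
def Tls : LaurentSeries Fq := HahnSeries.single (-1 : ℤ) (1 : Fq)

/-- The embedding of `F_q[T]` into `F_q((T⁻¹))`. -/
def toLS : Polynomial Fq →+* LaurentSeries Fq :=
  (Polynomial.aeval (Tls Fq)).toRingHom

/-- The absolute value `|ξ| = q^{-N}` where `ξ = Σ_{n ≥ N} a_n T^{-n}`, `a_N ≠ 0`. -/
def absQ (ξ : LaurentSeries Fq) : ℝ :=
  if ξ = 0 then 0 else (Fintype.card Fq : ℝ) ^ (-ξ.order)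

/-- Absolute value of a polynomial in `T`:  `|f| = q^{deg f}`. -/
def pabs (f : Polynomial Fq) : ℝ := absQ Fq (toLS Fq f)

/-- The height of a polynomial `P(X) ∈ (F_q[T])[X]`: the maximum of the absolute
values of its coefficients. -/
def Hpoly (P : Polynomial (Polynomial Fq)) : ℝ :=
  sSup {x : ℝ | ∃ i, x = pabs Fq (P.coeff i)}

/-- `ξ` has the (infinite) continued fraction expansion `[a₀; a₁, a₂, …]`, where all
partial quotients `aₙ`, `n ≥ 1`, have positive degree.  This is expressed via the
sequence of complete quotients (tails) `t n`, which satisfy `t n = a n + 1/(t (n+1))`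
and `|t n| > 1` for `n ≥ 1`. -/
def IsCF (ξ : LaurentSeries Fq) (a : ℕ → Polynomial Fq) : Prop :=
  (∀ n, 1 ≤ n → 1 ≤ (a n).natDegree) ∧
  ∃ t : ℕ → LaurentSeries Fq, t 0 = ξ ∧
    (∀ n, t n = toLS Fq (a n) + (t (n + 1))⁻¹) ∧
    (∀ n, 1 ≤ n → 1 < absQ Fq (t n))

/-- Denominators of the convergents: `q₀ = 1`, `q₁ = a₁`, `qₙ = aₙ q_{n-1} + q_{n-2}`. -/
def qden (a : ℕ → Polynomial Fq) : ℕ → Polynomial Fq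
  | 0 => 1
  | 1 => a 1
  | n + 2 => a (n + 2) * qden a (n + 1) + qden a n

/-- Evaluation of `P(X) ∈ (F_q[T])[X]` at a Laurent series. -/
def evalLS (P : Polynomial (Polynomial Fq)) (ξ : LaurentSeries Fq) : LaurentSeries Fq :=
  Polynomial.eval₂ (toLS Fq) ξ P

/-- The degree of an algebraic Laurent series over `F_q(T)`: the least degree of a
nonzero polynomial over `F_q[T]` annihilating it. -/
def degLS (ξ : LaurentSeries Fq) : ℕ :=
  sInf {d | ∃ P : Polynomial (Polynomial Fq), P ≠ 0 ∧ P.natDegree = d ∧ evalLS Fq P ξ = 0}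

/-- The height of an algebraic Laurent series: the least height of a nonzero annihilating
polynomial of minimal degree (this is the height of the primitive minimal polynomial). -/
def heightLS (ξ : LaurentSeries Fq) : ℝ :=
  sInf {x | ∃ P : Polynomial (Polynomial Fq),
    P ≠ 0 ∧ P.natDegree = degLS Fq ξ ∧ evalLS Fq P ξ = 0 ∧ x = Hpoly Fq P}

/-- The Diophantine exponent `w_n(ξ)`. -/
def wExp (n : ℕ) (ξ : LaurentSeries Fq) : EReal :=
  sSup ((fun w : ℝ => (w : EReal)) ''
    {w | {P : Polynomial (Polynomial Fq) | P.natDegree ≤ n ∧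
      0 < absQ Fq (evalLS Fq P ξ) ∧
      absQ Fq (evalLS Fq P ξ) ≤ Hpoly Fq P ^ (-w)}.Infinite})

variable (L : Type) [Field L] [Algebra (LaurentSeries Fq) L]

/-- The embedding of `F_q[T]` into a field extension `L` of `F_q((T⁻¹))`. -/
def embRing : Polynomial Fq →+* L :=
  (algebraMap (LaurentSeries Fq) L).comp (toLS Fq)

/-- Evaluation of `P(X) ∈ (F_q[T])[X]` at `α ∈ L`. -/
def evalA (P : Polynomial (Polynomial Fq)) (α : L) : L :=
  Polynomial.eval₂ (embRing Fq L) α P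

/-- The degree of an algebraic `α ∈ L` over `F_q(T)`. -/
def degA (α : L) : ℕ :=
  sInf {d | ∃ P : Polynomial (Polynomial Fq), P ≠ 0 ∧ P.natDegree = d ∧ evalA Fq L P α = 0}

/-- The height of an algebraic `α ∈ L`: the height of its primitive minimal polynomial
over `F_q[T]`. -/
def heightA (α : L) : ℝ :=
  sInf {x | ∃ P : Polynomial (Polynomial Fq),
    P ≠ 0 ∧ P.natDegree = degA Fq L α ∧ evalA Fq L P α = 0 ∧ x = Hpoly Fq P}

/-- `α ∈ L` is algebraic of degree at most `n` over `F_q(T)`. -/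
def IsAlgDeg (n : ℕ) (α : L) : Prop :=
  ∃ P : Polynomial (Polynomial Fq), P ≠ 0 ∧ P.natDegree ≤ n ∧ evalA Fq L P α = 0

/-- The Diophantine exponent `w_n^*(ξ)`, computed with respect to an extension `L` of
`F_q((T⁻¹))` (to be taken algebraically closed) endowed with an absolute value `v`
extending `absQ`. -/
def wstarExp (n : ℕ) (ξ : LaurentSeries Fq) (v : AbsoluteValue L ℝ) : EReal :=
  sSup ((fun w : ℝ => (w : EReal)) ''
    {w | {α : L | IsAlgDeg Fq L n α ∧
      0 < v (algebraMap (LaurentSeries Fq) L ξ - α) ∧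
      v (algebraMap (LaurentSeries Fq) L ξ - α) ≤ heightA Fq L α ^ (-w - 1)}.Infinite})

end CFq

end

namespace CFq

section Nonarchimedean

variable {K : Type*} [Field K] {v : AbsoluteValue K ℝ}

/-- Two sequences of complete quotients with the same partial quotients coincide. -/
theorem tails_unique (hv : IsNonarchimedean v) {c : ℝ} (hc : 1 < c) {A t u : ℕ → K}
    (hA : ∀ n, c ≤ v (A n))
    (ht : ∀ n, t n = A n + (t (n + 1))⁻¹) (hu : ∀ n, u n = A n + (u (n + 1))⁻¹)
    (ht1 : ∀ n, 1 < v (t n)) (hu1 : ∀ n, 1 < v (u n)) (n : ℕ) : t n = u n := by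
  have hinv : ∀ x : K, 1 < v x → v x⁻¹ < 1 := fun x hx => by
    rw [map_inv₀]; exact inv_lt_one_of_one_lt₀ hx
  have htA : ∀ n, c ≤ v (t n) := fun n => by
    rw [ht n, hv.add_eq_left_of_lt ((hinv _ (ht1 _)).trans (hc.trans_le (hA n)))]
    exact hA n
  have hne : ∀ x : K, 1 < v x → x ≠ 0 := fun x hx h => by
    rw [h, map_zero] at hx; linarith
  have hd : ∀ n, t n - u n = -(t (n + 1) - u (n + 1)) * ((t (n + 1))⁻¹ * (u (n + 1))⁻¹) := by
    intro n
    rw [ht n, hu n]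
    have h1 := hne _ (ht1 (n + 1))
    have h2 := hne _ (hu1 (n + 1))
    field_simp
    ring
  have hbound : ∀ k n, v (t n - u n) ≤ (c⁻¹) ^ k := by
    intro k
    induction k with
    | zero =>
      intro n
      have h : t n - u n = (t (n + 1))⁻¹ + -(u (n + 1))⁻¹ := by rw [ht n, hu n]; ring
      rw [h, pow_zero]
      refine (hv _ _).trans (max_le (hinv _ (ht1 _)).le ?_)
      rw [v.map_neg]
      exact (hinv _ (hu1 _)).le
    | succ k ih =>
      intro n
      rw [hd n, v.map_mul, v.map_neg, v.map_mul, pow_succ]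
      have h1 : v (t (n + 1))⁻¹ ≤ c⁻¹ := by
        rw [map_inv₀]; exact inv_anti₀ (by linarith) (htA _)
      have h2 := (hinv _ (hu1 (n + 1))).le
      have hc0 : 0 < c⁻¹ := by positivity
      refine mul_le_mul (ih _) ?_ (by positivity) (by positivity)
      calc _ ≤ c⁻¹ * 1 := mul_le_mul h1 h2 (by positivity) hc0.le
        _ = c⁻¹ := mul_one _
  have hlim : Filter.Tendsto (fun k : ℕ => (c⁻¹) ^ k) Filter.atTop (nhds 0) :=
    tendsto_pow_atTop_nhds_zero_of_lt_one (by positivity) (inv_lt_one_of_one_lt₀ hc)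
  have h0 : v (t n - u n) ≤ 0 := ge_of_tendsto' hlim fun k => hbound k n
  exact sub_eq_zero.1 (v.nonpos_iff.1 h0)

/-- A purely periodic sequence with the same partial quotients as, but different from, the
complete quotients of a continued fraction lies in the open unit ball. -/
theorem periodic_tails_lt_one (hv : IsNonarchimedean v) {c : ℝ} (hc : 1 < c) {A t u : ℕ → K}
    (hA : ∀ n, c ≤ v (A n))
    (ht : ∀ n, t n = A n + (t (n + 1))⁻¹) (hu : ∀ n, u n = A n + (u (n + 1))⁻¹)
    (ht1 : ∀ n, 1 < v (t n)) (hu0 : ∀ n, u n ≠ 0) {s : ℕ} (hs : 1 ≤ s)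
    (hper : ∀ n, u (n + s) = u n) (hne : t 0 ≠ u 0) (n : ℕ) : v (u n) < 1 := by
  have hex : ∃ n, v (u n) < 1 := by
    by_contra! h
    refine hne (tails_unique hv hc hA ht hu ht1 (fun n => ?_) 0)
    have h1 : v (u (n + 1))⁻¹ ≤ 1 := by
      rw [map_inv₀]; exact inv_le_one_of_one_le₀ (h _)
    rw [hu n, hv.add_eq_left_of_lt (h1.trans_lt (hc.trans_le (hA n)))]
    exact hc.trans_le (hA n)
  obtain ⟨m, hm⟩ := hex
  have hforward : ∀ k, v (u (m + k)) < 1 := by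
    intro k
    induction k with
    | zero => exact hm
    | succ k ih =>
      have h1 : (u (m + k + 1))⁻¹ = -A (m + k) + u (m + k) := by rw [hu (m + k)]; ring
      have h2 : v (u (m + k + 1))⁻¹ = v (A (m + k)) := by
        rw [h1, hv.add_eq_left_of_lt (by rw [v.map_neg]; linarith [hA (m + k)]), v.map_neg]
      rw [map_inv₀] at h2
      have h3 : 1 < (v (u (m + k + 1)))⁻¹ := by rw [h2]; exact hc.trans_le (hA _)
      have h4 : 0 < v (u (m + k + 1)) := v.pos (hu0 _)
      exact (one_lt_inv₀ h4).1 h3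
  have hmul : ∀ k, u (n + k * s) = u n := by
    intro k
    induction k with
    | zero => simp
    | succ k ih => rw [Nat.succ_mul, ← add_assoc, hper, ih]
  obtain ⟨k, hk⟩ : ∃ k, n + m * s = m + k :=
    Nat.exists_eq_add_of_le ((Nat.le_mul_of_pos_right m hs).trans (Nat.le_add_left _ _))
  rw [← hmul m, hk]
  exact hforward k

theorem denom_ratio (hv : IsNonarchimedean v) {A Q : ℕ → K} (hA : ∀ n, 1 ≤ n → 1 < v (A n))
    (hQ0 : Q 0 = 1) (hQ1 : Q 1 = A 1) (hQ : ∀ n, Q (n + 2) = A (n + 2) * Q (n + 1) + Q n)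
    (m : ℕ) : ∃ δ, v δ < 1 ∧ Q (m + 1) = (A (m + 1) + δ) * Q m ∧ Q m ≠ 0 := by
  induction m with
  | zero => exact ⟨0, by simp, by simp [hQ0, hQ1], by simp [hQ0]⟩
  | succ m ih =>
    obtain ⟨δ, hδ, hm, hm0⟩ := ih
    have hA1 := hA (m + 1) (by omega)
    have h1 : v (A (m + 1) + δ) = v (A (m + 1)) := hv.add_eq_left_of_lt (hδ.trans hA1)
    have h2 : A (m + 1) + δ ≠ 0 := v.pos_iff.1 (by rw [h1]; linarith)
    refine ⟨(A (m + 1) + δ)⁻¹, ?_, ?_, ?_⟩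
    · rw [map_inv₀, h1]; exact inv_lt_one_of_one_lt₀ hA1
    · rw [hQ, hm]; field_simp
    · rw [hm]; exact mul_ne_zero h2 hm0

theorem tails_sub_mul_denoms {A Q t u : ℕ → K}
    (hQ0 : Q 0 = 1) (hQ1 : Q 1 = A 1) (hQ : ∀ n, Q (n + 2) = A (n + 2) * Q (n + 1) + Q n)
    (ht : ∀ n, t n = A n + (t (n + 1))⁻¹) (hu : ∀ n, u n = A n + (u (n + 1))⁻¹)
    (ht0 : ∀ n, 1 ≤ n → t n ≠ 0) (hu0 : ∀ n, 1 ≤ n → u n ≠ 0) (m : ℕ) :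
    (t 0 - u 0) * ((Q (m + 1) * t (m + 2) + Q m) * (Q (m + 1) * u (m + 2) + Q m)) =
      (-1) ^ m * (t (m + 2) - u (m + 2)) := by
  have hmul : ∀ w : ℕ → K, (∀ n, w n = A n + (w (n + 1))⁻¹) → (∀ n, 1 ≤ n → w n ≠ 0) →
      ∀ n, w n * w (n + 1) = A n * w (n + 1) + 1 := by
    intro w hw hw0 n
    have := hw0 (n + 1) (by omega)
    rw [hw n]; field_simp
  have hd : ∀ n, (t n - u n) * (t (n + 1) * u (n + 1)) = -(t (n + 1) - u (n + 1)) := by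
    intro n
    linear_combination u (n + 1) * hmul t ht ht0 n - t (n + 1) * hmul u hu hu0 n
  induction m with
  | zero =>
    have ht2 := hmul t ht ht0 1
    have hu2 := hmul u hu hu0 1
    have h1 := hd 0
    have h2 := hd 1
    simp only [zero_add, Nat.reduceAdd] at *
    rw [hQ0, hQ1, ← ht2, ← hu2]
    linear_combination (t 2 * u 2) * h1 - h2
  | succ m ih =>
    have ht2 := hmul t ht ht0 (m + 2)
    have hu2 := hmul u hu hu0 (m + 2)
    have h2 := hd (m + 2)
    have e : ∀ w : ℕ → K, w (m + 2) * w (m + 2 + 1) = A (m + 2) * w (m + 2 + 1) + 1 →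
        Q (m + 1 + 1) * w (m + 1 + 2) + Q (m + 1) =
          w (m + 2 + 1) * (Q (m + 1) * w (m + 2) + Q m) := by
      intro w hw
      rw [show m + 1 + 1 = m + 2 from rfl, hQ, show m + 1 + 2 = m + 2 + 1 from rfl]
      linear_combination -Q (m + 1) * hw
    rw [e t ht2, e u hu2, pow_succ, show m + 1 + 2 = m + 2 + 1 from rfl]
    linear_combination (t (m + 2 + 1) * u (m + 2 + 1)) * ih + (-1) ^ m * h2

/-- The distance between an eventually periodic continued fraction and its conjugate. -/
theorem conj_dist (hv : IsNonarchimedean v) {x y β q q' d δ ε a b D e : K}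
    (hx : x = a + δ) (hy : y = b + ε) (hδ : v δ < 1) (hε : v ε < 1)
    (ha : 1 < v a) (hb : 1 < v b) (hab : 1 ≤ v (b - a))
    (hq : q = x * q') (hq' : q' ≠ 0) (hβ : 1 < v β) (he : v e = 1)
    (h : D * ((q * β + q') * (q * d + q')) = e * (β - d)) (hd : d = -y⁻¹) :
    v D * v q ^ 2 * v (b - a) = v a * v b := by
  have hvx : v x = v a := by rw [hx, hv.add_eq_left_of_lt (hδ.trans ha)]
  have hvy : v y = v b := by rw [hy, hv.add_eq_left_of_lt (hε.trans hb)]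
  have hx0 : x ≠ 0 := v.pos_iff.1 (by rw [hvx]; linarith)
  have hy0 : y ≠ 0 := v.pos_iff.1 (by rw [hvy]; linarith)
  have hq'0 : 0 < v q' := v.pos hq'
  have hvyx : v (y - x) = v (b - a) := by
    have h1 : y - x = (b - a) + (ε + -δ) := by rw [hx, hy]; ring
    have h2 : v (ε + -δ) < 1 :=
      (hv _ _).trans_lt (max_lt hε (by rwa [v.map_neg]))
    rw [h1, hv.add_eq_left_of_lt (h2.trans_le hab)]
  have hvd : v d < 1 := by
    rw [hd, v.map_neg, map_inv₀, hvy]; exact inv_lt_one_of_one_lt₀ hb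
  have hvβd : v (β - d) = v β := by
    rw [sub_eq_add_neg, hv.add_eq_left_of_lt (by rw [v.map_neg]; linarith)]
  have hvq : v q = v a * v q' := by rw [hq, v.map_mul, hvx]
  have h1 : v (q * β + q') = v q * v β := by
    rw [hv.add_eq_left_of_lt, v.map_mul]
    rw [v.map_mul, hvq]
    nlinarith [mul_lt_mul_of_pos_right ha hq'0, mul_pos (by linarith : 0 < v a) hq'0]
  have h2 : (q * d + q') * y = q' * (y - x) := by
    rw [hq, hd]; field_simp; ring
  have h2' := congrArg v h2
  rw [v.map_mul, v.map_mul, hvy, hvyx] at h2'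
  have h3 := congrArg v h
  rw [v.map_mul, v.map_mul, v.map_mul, h1, he, hvβd, one_mul] at h3
  have h4 : v D * v q * v (q * d + q') = 1 := by
    have : v β ≠ 0 := by positivity
    apply mul_right_cancel₀ this
    linear_combination h3
  calc v D * v q ^ 2 * v (b - a) = v D * v q * v a * (v q' * v (b - a)) := by
        rw [pow_two]; nth_rw 2 [hvq]; ring
    _ = (v D * v q * v (q * d + q')) * (v a * v b) := by rw [← h2']; ring
    _ = v a * v b := by rw [h4, one_mul]

end Nonarchimedean

section Conjugation

variable {R K : Type*} [CommRing R] [Field K] (φ : R →+* K) (α α' : K)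

/-- `u` and `w` have the same coordinates over the fraction field of `R` in the pairs `1, α` and
`1, α'` respectively. -/
def Conj (u w : K) : Prop :=
  ∃ x y z : R, φ z ≠ 0 ∧ φ z * u = φ x + φ y * α ∧ φ z * w = φ x + φ y * α'

variable {φ α α'}

theorem Conj.sub_map {u w : K} (h : Conj φ α α' u w) (a : R) :
    Conj φ α α' (u - φ a) (w - φ a) := by
  obtain ⟨x, y, z, hz, hu, hw⟩ := h
  refine ⟨x - z * a, y, z, hz, ?_, ?_⟩
  · rw [map_sub, map_mul]; linear_combination hu
  · rw [map_sub, map_mul]; linear_combination hw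

theorem Conj.ne_zero (hirr : ∀ x y : R, φ x + φ y * α' = 0 → φ x = 0 ∧ φ y = 0) {u w : K}
    (h : Conj φ α α' u w) (hu0 : u ≠ 0) : w ≠ 0 := by
  rintro rfl
  obtain ⟨x, y, z, hz, hu, hw⟩ := h
  obtain ⟨hx, hy⟩ := hirr x y (by rw [← hw, mul_zero])
  rw [hx, hy, zero_mul, add_zero] at hu
  exact mul_ne_zero hz hu0 hu

theorem Conj.unique (hirr : ∀ x y : R, φ x + φ y * α = 0 → φ x = 0 ∧ φ y = 0) {u w w' : K}
    (h : Conj φ α α' u w) (h' : Conj φ α α' u w') : w = w' := by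
  obtain ⟨x, y, z, hz, hu, hw⟩ := h
  obtain ⟨x', y', z', hz', hu', hw'⟩ := h'
  obtain ⟨hx, hy⟩ := hirr (z' * x - z * x') (z' * y - z * y') (by
    simp only [map_sub, map_mul]
    linear_combination -φ z' * hu + φ z * hu')
  simp only [map_sub, map_mul] at hx hy
  apply mul_left_cancel₀ (mul_ne_zero hz hz')
  linear_combination φ z' * hw - φ z * hw' + hx + α' * hy

theorem Conj.inv {c₀ c₁ c₂ : R} (hc : φ c₂ ≠ 0) (hsum : φ c₂ * (α + α') + φ c₁ = 0)
    (hprod : φ c₂ * (α * α') = φ c₀) {u w : K}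
    (h : Conj φ α α' u w) (hu0 : u ≠ 0) (hw0 : w ≠ 0) : Conj φ α α' u⁻¹ w⁻¹ := by
  obtain ⟨x, y, z, hz, hu, hw⟩ := h
  have hN : φ (c₂ * x ^ 2 - c₁ * x * y + c₀ * y ^ 2) = φ c₂ * φ z ^ 2 * u * w := by
    simp only [map_sub, map_mul, map_add, map_pow]
    linear_combination -φ x * φ y * hsum - φ y ^ 2 * hprod - φ c₂ * φ z * w * hu
      - φ c₂ * (φ x + φ y * α) * hw
  refine ⟨z * (c₂ * x - c₁ * y), -(z * c₂ * y), c₂ * x ^ 2 - c₁ * x * y + c₀ * y ^ 2, ?_, ?_, ?_⟩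
  · rw [hN]
    exact mul_ne_zero (mul_ne_zero (mul_ne_zero hc (pow_ne_zero _ hz)) hu0) hw0
  · have : φ c₂ * φ z ^ 2 * u * w * u⁻¹ = φ c₂ * φ z ^ 2 * w := by field_simp
    rw [hN, this]
    simp only [map_sub, map_mul, map_neg]
    linear_combination φ c₂ * φ z * hw + φ z * φ y * hsum
  · have : φ c₂ * φ z ^ 2 * u * w * w⁻¹ = φ c₂ * φ z ^ 2 * u := by field_simp
    rw [hN, this]
    simp only [map_sub, map_mul, map_neg]
    linear_combination φ c₂ * φ z * hu + φ z * φ y * hsum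

end Conjugation

section LaurentSeries

variable {Fq : Type} [Field Fq]

theorem toLS_X : toLS Fq X = Tls Fq := by simp [toLS]

theorem irrational_of_degLS {α : LaurentSeries Fq} (h : degLS Fq α = 2) (x y : Polynomial Fq)
    (hxy : toLS Fq x + toLS Fq y * α = 0) : x = 0 ∧ y = 0 := by
  by_contra hne
  have hP : C x + C y * X ≠ (0 : Polynomial (Polynomial Fq)) := by
    intro h0
    refine hne ⟨?_, ?_⟩
    · simpa using congrArg (fun p => coeff p 0) h0
    · simpa using congrArg (fun p => coeff p 1) h0
  have hle : degLS Fq α ≤ (C x + C y * X : Polynomial (Polynomial Fq)).natDegree :=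
    Nat.sInf_le ⟨_, hP, rfl, by simpa [evalLS, eval₂_add, eval₂_mul] using hxy⟩
  have : (C x + C y * X : Polynomial (Polynomial Fq)).natDegree ≤ 1 := by
    rw [add_comm]; exact natDegree_linear_le
  omega

end LaurentSeries

section AbsQ

variable (Fq : Type) [Field Fq] [Fintype Fq]

theorem one_lt_card : (1 : ℝ) < Fintype.card Fq := by
  exact_mod_cast Fintype.one_lt_card

theorem absQ_nonneg (x : LaurentSeries Fq) : 0 ≤ absQ Fq x := by
  unfold absQ
  split_ifs
  exacts [le_rfl, by positivity]

theorem absQ_add_le (x y : LaurentSeries Fq) :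
    absQ Fq (x + y) ≤ max (absQ Fq x) (absQ Fq y) := by
  have hq := one_lt_card Fq
  by_cases hx : x = 0
  · simp [hx]
  by_cases hy : y = 0
  · simp [hy]
  by_cases hxy : x + y = 0
  · rw [hxy]
    exact le_max_of_le_left (by simpa [absQ] using absQ_nonneg Fq x)
  simp only [absQ, hx, hy, hxy, if_false]
  rcases min_le_iff.1 (HahnSeries.min_order_le_order_add hxy) with h | h
  · exact le_max_of_le_left (zpow_le_zpow_right₀ hq.le (by omega))
  · exact le_max_of_le_right (zpow_le_zpow_right₀ hq.le (by omega))

/-- `absQ` as a bundled absolute value. -/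
noncomputable def absQVal : AbsoluteValue (LaurentSeries Fq) ℝ where
  toFun := absQ Fq
  map_mul' x y := by
    have hq := one_lt_card Fq
    by_cases hx : x = 0
    · simp [hx, absQ]
    by_cases hy : y = 0
    · simp [hy, absQ]
    simp only [absQ, hx, hy, mul_ne_zero hx hy, if_false]
    rw [HahnSeries.order_mul hx hy, neg_add, zpow_add₀ (by positivity)]
  nonneg' := absQ_nonneg Fq
  eq_zero' x := by
    have hq := one_lt_card Fq
    refine ⟨fun h => ?_, fun h => by simp [h, absQ]⟩
    by_contra hx
    simp only [absQ, hx, if_false] at h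
    exact absurd h (by positivity)
  add_le' x y := (absQ_add_le Fq x y).trans
    (max_le_add_of_nonneg (absQ_nonneg Fq x) (absQ_nonneg Fq y))

theorem absQVal_isNonarchimedean : IsNonarchimedean (absQVal Fq) := absQ_add_le Fq

theorem absQVal_Tls : absQVal Fq (Tls Fq) = Fintype.card Fq := by
  change absQ Fq (Tls Fq) = _
  simp [absQ, Tls, HahnSeries.order_single]

theorem absQVal_toLS_C {c : Fq} (hc : c ≠ 0) : absQVal Fq (toLS Fq (C c)) = 1 := by
  have h : absQVal Fq (toLS Fq (C c)) ^ (Fintype.card Fq - 1) = 1 := by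
    rw [← AbsoluteValue.map_pow, ← map_pow, ← C_pow, FiniteField.pow_card_sub_one_eq_one c hc]
    simp
  refine (pow_eq_one_iff_of_nonneg (by positivity) ?_).1 h
  have := Fintype.one_lt_card (α := Fq)
  omega

theorem absQVal_toLS_ge (n : ℕ) : ∀ f : Polynomial Fq, f.natDegree = n → f ≠ 0 →
    1 ≤ absQVal Fq (toLS Fq f) ∧
      (1 ≤ n → (Fintype.card Fq : ℝ) ≤ absQVal Fq (toLS Fq f)) := by
  have hq := one_lt_card Fq
  induction n with
  | zero =>
    intro f hf hf0
    obtain ⟨c, rfl⟩ := Polynomial.natDegree_eq_zero.1 hf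
    rw [absQVal_toLS_C Fq (by simpa using hf0)]
    exact ⟨le_rfl, by omega⟩
  | succ n ih =>
    intro f hf hf0
    have hdeg : f.divX.natDegree = n := by
      rw [Polynomial.natDegree_divX_eq_natDegree_tsub_one, hf]; rfl
    have hdiv : f.divX ≠ 0 := by
      intro h
      rw [Polynomial.divX_eq_zero_iff] at h
      rw [h, natDegree_C] at hf
      omega
    have h1 := (ih _ hdeg hdiv).1
    have hmul : (Fintype.card Fq : ℝ) ≤ absQVal Fq (toLS Fq (f.divX * X)) := by
      rw [map_mul, AbsoluteValue.map_mul, toLS_X, absQVal_Tls]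
      nlinarith
    have hC : absQVal Fq (toLS Fq (C (f.coeff 0))) ≤ 1 := by
      by_cases h : f.coeff 0 = 0
      · simp [h]
      · exact (absQVal_toLS_C Fq h).le
    have h2 : absQVal Fq (toLS Fq f) = absQVal Fq (toLS Fq (f.divX * X)) := by
      conv_lhs => rw [← Polynomial.divX_mul_X_add f, map_add]
      exact (absQVal_isNonarchimedean Fq).add_eq_left_of_lt (by linarith)
    rw [h2]
    exact ⟨by linarith, fun _ => hmul⟩

theorem one_le_absQVal_toLS {f : Polynomial Fq} (hf : f ≠ 0) : 1 ≤ absQVal Fq (toLS Fq f) :=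
  (absQVal_toLS_ge Fq _ f rfl hf).1

theorem card_le_absQVal_toLS {f : Polynomial Fq} (hf : 1 ≤ f.natDegree) :
    (Fintype.card Fq : ℝ) ≤ absQVal Fq (toLS Fq f) :=
  (absQVal_toLS_ge Fq _ f rfl (by rintro rfl; simp at hf)).2 hf

theorem toLS_eq_zero {f : Polynomial Fq} (h : toLS Fq f = 0) : f = 0 := by
  by_contra hf
  have := one_le_absQVal_toLS Fq hf
  rw [h, map_zero] at this
  linarith

variable {Fq}

theorem vieta_of_evalLS {P : Polynomial (Polynomial Fq)} (hP : P.natDegree = 2)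
    {α α' : LaurentSeries Fq} (hα : evalLS Fq P α = 0) (hα' : evalLS Fq P α' = 0)
    (hne : α ≠ α') : toLS Fq (P.coeff 2) ≠ 0 ∧
      toLS Fq (P.coeff 2) * (α + α') + toLS Fq (P.coeff 1) = 0 ∧
      toLS Fq (P.coeff 2) * (α * α') = toLS Fq (P.coeff 0) := by
  simp only [evalLS, eval₂_eq_sum_range, hP, Finset.sum_range_succ, Finset.sum_range_zero,
    pow_zero, pow_one, mul_one, zero_add] at hα hα'
  have hsum : toLS Fq (P.coeff 2) * (α + α') + toLS Fq (P.coeff 1) = 0 := by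
    apply mul_left_cancel₀ (sub_ne_zero.2 hne)
    linear_combination hα - hα'
  refine ⟨fun h => ?_, hsum, by linear_combination α * hsum - hα⟩
  have h2 := toLS_eq_zero Fq h
  rw [← hP, coeff_natDegree, leadingCoeff_eq_zero] at h2
  simp [h2] at hP

end AbsQ

end CFq

/-- bounds for the distance between an ultimately periodic continued
fraction and its Galois conjugate. -/
theorem stmt5 (Fq : Type) [Field Fq] [Fintype Fq]
    (r s : ℕ) (hr : 1 ≤ r) (hs : 1 ≤ s) (a : ℕ → Polynomial Fq)
    (α α' : LaurentSeries Fq)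
    (hcf : CFq.IsCF Fq α a) (ha0 : a 0 = 0)
    (hper : ∀ n, r + 1 ≤ n → a (n + s) = a n)
    (hars : a r ≠ a (r + s))
    (hdeg : CFq.degLS Fq α = 2)
    (hconj : ∃ P : Polynomial (Polynomial Fq), P ≠ 0 ∧ P.natDegree = 2 ∧
      CFq.evalLS Fq P α = 0 ∧ CFq.evalLS Fq P α' = 0)
    (hne : α ≠ α') :
    min (CFq.pabs Fq (a r)) (CFq.pabs Fq (a (r + s))) / CFq.pabs Fq (CFq.qden Fq a r) ^ 2
        ≤ CFq.absQ Fq (α - α') ∧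
      CFq.absQ Fq (α - α') ≤
        CFq.pabs Fq (a r * a (r + s)) / CFq.pabs Fq (CFq.qden Fq a r) ^ 2 := by
  obtain ⟨hA, t, ht0, ht, ht1⟩ := hcf
  obtain ⟨P, -, hP2, hPα, hPα'⟩ := hconj
  obtain ⟨hc, hsum, hprod⟩ := CFq.vieta_of_evalLS hP2 hPα hPα' hne
  have hv := CFq.absQVal_isNonarchimedean Fq
  have hq := CFq.one_lt_card Fq
  have hirr : ∀ x y : Polynomial Fq, CFq.toLS Fq x + CFq.toLS Fq y * α = 0 →
      CFq.toLS Fq x = 0 ∧ CFq.toLS Fq y = 0 := fun x y hxy => by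
    obtain ⟨hx, hy⟩ := CFq.irrational_of_degLS hdeg x y hxy
    simp [hx, hy]
  have hirr' : ∀ x y : Polynomial Fq, CFq.toLS Fq x + CFq.toLS Fq y * α' = 0 →
      CFq.toLS Fq x = 0 ∧ CFq.toLS Fq y = 0 := fun x y hxy => by
    obtain ⟨-, hy⟩ := hirr (P.coeff 2 * x - P.coeff 1 * y) (-(P.coeff 2 * y)) (by
      simp only [map_sub, map_mul, map_neg]
      linear_combination CFq.toLS Fq (P.coeff 2) * hxy - CFq.toLS Fq y * hsum)
    rw [map_neg, map_mul, neg_eq_zero] at hy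
    have hy0 := (mul_eq_zero.1 hy).resolve_left hc
    rw [hy0, zero_mul, add_zero] at hxy
    exact ⟨hxy, hy0⟩
  have htne : ∀ n, 1 ≤ n → t n ≠ 0 := fun n hn =>
    (CFq.absQVal Fq).pos_iff.1 (zero_lt_one.trans (ht1 n hn))
  obtain ⟨u, hu0, hus⟩ : ∃ u : ℕ → LaurentSeries Fq, u 0 = α' ∧
      ∀ n, u (n + 1) = (u n - CFq.toLS Fq (a n))⁻¹ :=
    ⟨fun n => Nat.rec α' (fun n x => (x - CFq.toLS Fq (a n))⁻¹) n, rfl, fun _ => rfl⟩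
  have htsub : ∀ n, t n - CFq.toLS Fq (a n) = (t (n + 1))⁻¹ := fun n => by
    rw [ht n]; ring
  have htsub0 : ∀ n, t n - CFq.toLS Fq (a n) ≠ 0 := fun n => by
    rw [htsub]; exact inv_ne_zero (htne _ (by omega))
  have hconj : ∀ n, CFq.Conj (CFq.toLS Fq) α α' (t n) (u n) := by
    intro n
    induction n with
    | zero => exact ⟨0, 1, 1, by simp, by simp [ht0], by simp [hu0]⟩
    | succ n ih =>
      have h := ih.sub_map (a n)
      rw [hus, show t (n + 1) = (t n - CFq.toLS Fq (a n))⁻¹ by rw [htsub, inv_inv]]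
      exact h.inv hc hsum hprod (htsub0 n) (h.ne_zero hirr' (htsub0 n))
  have hune : ∀ n, 1 ≤ n → u n ≠ 0 := fun n hn => (hconj n).ne_zero hirr' (htne n hn)
  have hu : ∀ n, u n = CFq.toLS Fq (a n) + (u (n + 1))⁻¹ := fun n => by
    rw [hus, inv_inv]; ring
  have hAc : ∀ n, 1 ≤ n → (Fintype.card Fq : ℝ) ≤ CFq.absQVal Fq (CFq.toLS Fq (a n)) :=
    fun n hn => CFq.card_le_absQVal_toLS Fq (hA n hn)
  have htper : ∀ n, t (n + s + (r + 1)) = t (n + (r + 1)) :=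
    CFq.tails_unique hv hq (A := fun n => CFq.toLS Fq (a (n + (r + 1))))
      (t := fun n => t (n + s + (r + 1))) (u := fun n => t (n + (r + 1)))
      (fun n => hAc _ (by omega))
      (fun n => by
        have h := ht (n + s + (r + 1))
        rw [show n + s + (r + 1) = n + (r + 1) + s by ring, hper _ (by omega)] at h
        rwa [show n + (r + 1) + s + 1 = n + 1 + s + (r + 1) by ring,
          show n + (r + 1) + s = n + s + (r + 1) by ring] at h)
      (fun n => by
        have h := ht (n + (r + 1))
        rwa [show n + (r + 1) + 1 = n + 1 + (r + 1) by ring] at h)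
      (fun n => ht1 _ (by omega)) (fun n => ht1 _ (by omega))
  have huper : ∀ n, u (n + s + (r + 1)) = u (n + (r + 1)) := fun n => by
    have h := hconj (n + s + (r + 1))
    rw [htper] at h
    exact h.unique hirr (hconj _)
  obtain ⟨m, rfl⟩ : ∃ m, r = m + 1 := ⟨r - 1, by omega⟩
  have hQ := CFq.tails_sub_mul_denoms (A := fun n => CFq.toLS Fq (a n))
    (Q := fun n => CFq.toLS Fq (CFq.qden Fq a n)) (t := t) (u := u)
    (by simp [CFq.qden]) (by simp [CFq.qden]) (fun n => by simp [CFq.qden]) ht hu htne hune m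
  obtain ⟨δ, hδ, hδq, hqm⟩ := CFq.denom_ratio hv (A := fun n => CFq.toLS Fq (a n))
    (Q := fun n => CFq.toLS Fq (CFq.qden Fq a n)) (fun n hn => hq.trans_le (hAc n hn))
    (by simp [CFq.qden]) (by simp [CFq.qden]) (fun n => by simp [CFq.qden]) m
  have htu : t (m + 2) ≠ u (m + 2) := fun h => by
    have hback : ∀ k, t k = u k → t 0 = u 0 := fun k => by
      induction k with
      | zero => exact id
      | succ k ih => exact fun hk => ih (by rw [ht k, hu k, hk])
    exact hne (by rw [← ht0, ← hu0, hback _ h])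
  have hult : ∀ n, CFq.absQVal Fq (u (n + (m + 2))) < 1 :=
    CFq.periodic_tails_lt_one hv hq (A := fun n => CFq.toLS Fq (a (n + (m + 2))))
      (t := fun n => t (n + (m + 2))) (u := fun n => u (n + (m + 2)))
      (fun n => hAc _ (by omega))
      (fun n => by
        have h := ht (n + (m + 2))
        rwa [show n + (m + 2) + 1 = n + 1 + (m + 2) by ring] at h)
      (fun n => by
        have h := hu (n + (m + 2))
        rwa [show n + (m + 2) + 1 = n + 1 + (m + 2) by ring] at h)
      (fun n => ht1 _ (by omega)) (fun n => hune _ (by omega)) hs huper (by simpa using htu)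
  have hε : CFq.absQVal Fq (-u (m + 1 + s)) < 1 := by
    rw [AbsoluteValue.map_neg]
    have h := hult (s - 1)
    rwa [show s - 1 + (m + 2) = m + 1 + s by omega] at h
  have hus' : u (m + 2) = -(CFq.toLS Fq (a (m + 1 + s)) + -u (m + 1 + s))⁻¹ := by
    have h := hus (m + 1 + s)
    have h0 := huper 0
    rw [show 0 + s + (m + 1 + 1) = m + 1 + s + 1 by ring, zero_add] at h0
    rw [← h0, h, ← inv_neg]
    ring_nf
  have hd1 : 1 ≤ CFq.absQVal Fq (CFq.toLS Fq (a (m + 1 + s)) - CFq.toLS Fq (a (m + 1))) := by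
    rw [← map_sub]
    exact CFq.one_le_absQVal_toLS Fq (sub_ne_zero.2 hars.symm)
  have hA1 := hq.trans_le (hAc (m + 1) (by omega))
  have hA2 := hq.trans_le (hAc (m + 1 + s) (by omega))
  rw [ht0, hu0] at hQ
  have key := CFq.conj_dist hv rfl rfl hδ hε hA1 hA2 hd1 hδq hqm (ht1 (m + 2) (by omega))
    (by simp [AbsoluteValue.map_pow]) hQ hus'
  have hdmax : CFq.absQVal Fq (CFq.toLS Fq (a (m + 1 + s)) - CFq.toLS Fq (a (m + 1))) ≤
      max (CFq.absQVal Fq (CFq.toLS Fq (a (m + 1))))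
        (CFq.absQVal Fq (CFq.toLS Fq (a (m + 1 + s)))) := by
    rw [sub_eq_add_neg, max_comm]
    refine (hv _ _).trans ?_
    rw [AbsoluteValue.map_neg]
  have hq0 : 0 < CFq.absQVal Fq (CFq.toLS Fq (CFq.qden Fq a (m + 1))) := by
    refine (CFq.absQVal Fq).pos fun h => ?_
    rw [h] at key
    simp only [map_zero] at key
    nlinarith
  unfold CFq.pabs
  rw [map_mul]
  change min (CFq.absQVal Fq _) (CFq.absQVal Fq _) / CFq.absQVal Fq _ ^ 2 ≤ CFq.absQVal Fq _ ∧
    CFq.absQVal Fq _ ≤ CFq.absQVal Fq _ / CFq.absQVal Fq _ ^ 2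
  rw [div_le_iff₀ (by positivity), le_div_iff₀ (by positivity), AbsoluteValue.map_mul]
  have hD : 0 ≤ CFq.absQVal Fq (α - α') * CFq.absQVal Fq (CFq.toLS Fq (CFq.qden Fq a (m + 1))) ^ 2 :=
    by positivity
  constructor
  · refine le_of_mul_le_mul_right ?_ (zero_lt_one.trans_le hd1)
    rw [key, ← min_mul_max (CFq.absQVal Fq (CFq.toLS Fq (a (m + 1))))]
    exact mul_le_mul_of_nonneg_left hdmax (le_min (by positivity) (by positivity))
  · rw [← key]
    exact le_mul_of_one_le_right hD hd1
end

section
/- Let n ≥ 1 be an integer and α ∈ F_q((T⁻¹)) be algebraic over F_q(T). Then w_n*(α) ≤ deg α − 1 and w_n(α) ≤ deg α − 1, where deg α is the degree of α over F_q(T). -/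
open Polynomial
open scoped Classical

section Liouville

variable {R K : Type*} [CommRing R] [Field K]

/-- If `Q(α) = 0` with `Q` of degree `k + 1` and leading coefficient `a`, then some square
matrix `A` over the base ring acts on `(1, α, …, α ^ k)` as multiplication by `a α`. -/
theorem exists_matrix_mulVec_pow (φ : R →+* K) (α : K) (k : ℕ) (Q : R[X])
    (hQ : Q.natDegree = k + 1) (hQα : eval₂ φ α Q = 0) :
    ∃ A : Matrix (Fin (k + 1)) (Fin (k + 1)) R,
      (φ.mapMatrix A).mulVec (fun i => α ^ (i : ℕ)) =
        (φ Q.leadingCoeff * α) • fun i : Fin (k + 1) => α ^ (i : ℕ) := by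
  have row : ∀ i : Fin (k + 1), ∃ r : Fin (k + 1) → R,
      ∑ j, φ (r j) * α ^ (j : ℕ) = φ Q.leadingCoeff * α * α ^ (i : ℕ) := by
    intro i
    by_cases hi : (i : ℕ) = k
    · refine ⟨fun j => -Q.coeff j, ?_⟩
      rw [eval₂_eq_sum_range, hQ, Finset.sum_range_succ, ← hQ] at hQα
      rw [Fin.sum_univ_eq_sum_range (fun j => φ (-Q.coeff j) * α ^ j), hi, leadingCoeff]
      simp only [map_neg, neg_mul, Finset.sum_neg_distrib]
      rw [hQ] at hQα ⊢
      linear_combination -hQα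
    · refine ⟨Pi.single ⟨i + 1, by omega⟩ Q.leadingCoeff, ?_⟩
      rw [Finset.sum_eq_single (⟨i + 1, by omega⟩ : Fin (k + 1))]
      · simp only [Pi.single_eq_same]
        ring
      · intro j _ hj
        simp [Pi.single_eq_of_ne hj]
      · simp
  choose r hr using row
  exact ⟨Matrix.of r, funext fun i => by simpa [Matrix.mulVec, dotProduct] using hr i⟩

theorem mapMatrix_pow_mulVec {m : Type*} [Fintype m] [DecidableEq m] (φ : R →+* K)
    (A : Matrix m m R) (x : K) (u : m → K) (h : (φ.mapMatrix A).mulVec u = x • u) (e : ℕ) :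
    (φ.mapMatrix (A ^ e)).mulVec u = x ^ e • u := by
  induction e with
  | zero => simp
  | succ e ih =>
    rw [pow_succ, map_mul, ← Matrix.mulVec_mulVec, h, Matrix.mulVec_smul, ih, smul_smul, pow_succ,
      mul_comm]

/-- If no nonzero polynomial of degree at most `k` vanishes at `α`, a matrix acting on
`(1, α, …, α ^ k)` as a nonzero scalar is nonsingular. -/
theorem det_ne_zero_of_mulVec_pow [IsDomain R] (φ : R →+* K) (α : K) (k : ℕ)
    (hmin : ∀ P : R[X], P ≠ 0 → eval₂ φ α P = 0 → k + 1 ≤ P.natDegree)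
    (M : Matrix (Fin (k + 1)) (Fin (k + 1)) R) (x : K) (hx : x ≠ 0)
    (h : (φ.mapMatrix M).mulVec (fun i => α ^ (i : ℕ)) =
      x • fun i : Fin (k + 1) => α ^ (i : ℕ)) : M.det ≠ 0 := by
  intro hdet
  obtain ⟨c, hc, hcM⟩ := Matrix.exists_vecMul_eq_zero_iff.2 hdet
  have h1 : dotProduct (φ ∘ c) ((φ.mapMatrix M).mulVec (fun i => α ^ (i : ℕ))) = 0 := by
    rw [Matrix.dotProduct_mulVec]
    have : Matrix.vecMul (φ ∘ c) (φ.mapMatrix M) = 0 := by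
      rw [RingHom.mapMatrix_apply]
      ext i
      rw [← RingHom.map_vecMul, hcM]
      simp
    rw [this, zero_dotProduct]
  rw [h, dotProduct_smul, smul_eq_mul, mul_eq_zero, or_iff_right hx] at h1
  have hcoeff : ∀ j : Fin (k + 1), (∑ i : Fin (k + 1), monomial (i : ℕ) (c i)).coeff j = c j := by
    intro j
    simp [coeff_monomial, Fin.val_inj]
  have hne : (∑ i : Fin (k + 1), monomial (i : ℕ) (c i)) ≠ 0 := by
    intro h0
    apply hc
    ext j
    rw [← hcoeff j, h0]
    simp
  have hdeg : (∑ i : Fin (k + 1), monomial (i : ℕ) (c i)).natDegree ≤ k :=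
    natDegree_sum_le_of_forall_le _ _ fun i _ => (natDegree_monomial_le _).trans (by omega)
  have := hmin _ hne (by simpa [eval₂_finsetSum, dotProduct] using h1)
  omega

/-- Liouville's inequality: if `α` has degree `k + 1`, then `|P(α)| ≥ c H(P) ^ (-k)` for all `P` of
degree at most `n` with `P(α) ≠ 0`. -/
theorem exists_liouville_bound [IsDomain R] (φ : R →+* K) (a : AbsoluteValue K ℝ)
    (hone : ∀ r : R, r ≠ 0 → 1 ≤ a (φ r)) (α : K) (k n : ℕ) (Q : R[X])
    (hQ : Q.natDegree = k + 1) (hQα : eval₂ φ α Q = 0)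
    (hmin : ∀ P : R[X], P ≠ 0 → eval₂ φ α P = 0 → k + 1 ≤ P.natDegree) :
    ∃ c : ℝ, 0 < c ∧ ∀ P : R[X], P.natDegree ≤ n → eval₂ φ α P ≠ 0 →
      ∀ H : ℝ, (∀ i, a (φ (P.coeff i)) ≤ H) → c ≤ a (eval₂ φ α P) * H ^ k := by
  have hφ : Function.Injective φ := by
    rw [injective_iff_map_eq_zero]
    intro r hr
    by_contra h0
    have := hone r h0
    rw [hr, map_zero] at this
    linarith
  obtain ⟨A, hA⟩ := exists_matrix_mulVec_pow φ α k Q hQ hQα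
  set u : Fin (k + 1) → K := fun i => α ^ (i : ℕ) with hu
  set l := Q.leadingCoeff with hl
  have hl0 : l ≠ 0 := leadingCoeff_ne_zero.2 fun h => by simp [h] at hQ
  let b : AbsoluteValue R ℝ := a.comp hφ
  have hb : ∀ r, b r = a (φ r) := fun r => rfl
  set C : ℝ := ∑ m ∈ Finset.range (n + 1), ∑ i, ∑ j, b ((l ^ (n - m) • A ^ m) i j) with hC
  set D : ℝ := b l ^ n * ∑ j : Fin (k + 1), k.factorial * C ^ k * a α ^ (j : ℕ) with hD
  have hC0 : 0 ≤ C := Finset.sum_nonneg fun _ _ => Finset.sum_nonneg fun _ _ =>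
    Finset.sum_nonneg fun _ _ => b.nonneg _
  have hD0 : 0 ≤ D := mul_nonneg (pow_nonneg (b.nonneg _) _) <| Finset.sum_nonneg fun j _ =>
    mul_nonneg (by positivity) (pow_nonneg (a.nonneg _) _)
  refine ⟨1 / (D + 1), by positivity, fun P hP hPα H hH => ?_⟩
  have hH0 : 0 ≤ H := (a.nonneg _).trans (hH 0)
  set M : Matrix (Fin (k + 1)) (Fin (k + 1)) R :=
    ∑ m ∈ Finset.range (n + 1), P.coeff m • (l ^ (n - m) • A ^ m) with hM
  set x : K := φ l ^ n * eval₂ φ α P with hx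
  have hx0 : x ≠ 0 := mul_ne_zero (pow_ne_zero _ ((map_ne_zero_iff φ hφ).2 hl0)) hPα
  have hsmul : ∀ (r : R) (N : Matrix (Fin (k + 1)) (Fin (k + 1)) R),
      φ.mapMatrix (r • N) = φ r • φ.mapMatrix N := by
    intro r N
    ext i j
    simp
  have hMu : (φ.mapMatrix M).mulVec u = x • u := by
    rw [hM, map_sum, Matrix.sum_mulVec, hx, eval₂_eq_sum_range' φ (Nat.lt_succ_of_le hP),
      Finset.mul_sum, Finset.sum_smul]
    refine Finset.sum_congr rfl fun m hm => ?_
    have hm' : n - m + m = n := Nat.sub_add_cancel (by simpa [Nat.lt_succ_iff] using hm)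
    rw [hsmul, hsmul, Matrix.smul_mulVec, Matrix.smul_mulVec,
      mapMatrix_pow_mulVec φ A _ u hA, smul_smul, smul_smul]
    congr 1
    calc φ (P.coeff m) * φ (l ^ (n - m)) * (φ l * α) ^ m
        = φ l ^ (n - m + m) * (φ (P.coeff m) * α ^ m) := by rw [map_pow, pow_add]; ring
      _ = _ := by rw [hm']
  have hdet := det_ne_zero_of_mulVec_pow φ α k hmin M x hx0 hMu
  have hkey : φ M.det = x * ∑ j, φ (M.adjugate 0 j) * α ^ (j : ℕ) := by
    have h1 : (φ.mapMatrix M.adjugate).mulVec ((φ.mapMatrix M).mulVec u) = φ M.det • u := by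
      rw [Matrix.mulVec_mulVec, ← map_mul, Matrix.adjugate_mul, hsmul, map_one,
        Matrix.smul_mulVec, Matrix.one_mulVec]
    rw [hMu, Matrix.mulVec_smul] at h1
    have h2 := congrFun h1 0
    simp only [Pi.smul_apply, smul_eq_mul, hu, Matrix.mulVec, dotProduct] at h2
    simpa using h2.symm
  have hMb : ∀ i j, b (M i j) ≤ H * C := by
    intro i j
    rw [hM, Matrix.sum_apply, hC, Finset.mul_sum]
    refine (b.sum_le _ _).trans (Finset.sum_le_sum fun m _ => ?_)
    rw [Matrix.smul_apply, smul_eq_mul, map_mul]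
    refine mul_le_mul (hH m) ?_ (b.nonneg _) hH0
    refine (Finset.single_le_sum (f := fun j => b ((l ^ (n - m) • A ^ m) i j))
      (fun _ _ => b.nonneg _) (Finset.mem_univ j)).trans ?_
    exact Finset.single_le_sum (f := fun i => ∑ j, b ((l ^ (n - m) • A ^ m) i j))
      (fun _ _ => Finset.sum_nonneg fun _ _ => b.nonneg _) (Finset.mem_univ i)
  have hadj : ∀ j, b (M.adjugate 0 j) ≤ k.factorial * (H * C) ^ k := by
    intro j
    rw [Matrix.adjugate_fin_succ_eq_det_submatrix, map_mul, map_pow, AbsoluteValue.map_neg, map_one,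
      one_pow, one_mul]
    simpa using Matrix.det_le (abv := b) (x := H * C)
      (A := M.submatrix j.succAbove (0 : Fin (k + 1)).succAbove) (fun i i' => hMb _ _)
  have hfin : 1 ≤ a (eval₂ φ α P) * H ^ k * D := by
    calc 1 ≤ a (φ M.det) := hone _ hdet
      _ = b l ^ n * a (eval₂ φ α P) * a (∑ j, φ (M.adjugate 0 j) * α ^ (j : ℕ)) := by
        rw [hkey, hx, map_mul, map_mul, map_pow, hb]
      _ ≤ b l ^ n * a (eval₂ φ α P) *
          ∑ j : Fin (k + 1), k.factorial * (H * C) ^ k * a α ^ (j : ℕ) := by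
        refine mul_le_mul_of_nonneg_left ?_
          (mul_nonneg (pow_nonneg (b.nonneg _) _) (a.nonneg _))
        refine (a.sum_le _ _).trans (Finset.sum_le_sum fun j _ => ?_)
        rw [map_mul, map_pow]
        exact mul_le_mul_of_nonneg_right (hadj j) (pow_nonneg (a.nonneg _) _)
      _ = a (eval₂ φ α P) * H ^ k * D := by
        clear_value C
        rw [hD, Finset.mul_sum, Finset.mul_sum, Finset.mul_sum]
        exact Finset.sum_congr rfl fun j _ => by ring
  rw [div_le_iff₀ (by positivity)]
  have : 0 ≤ a (eval₂ φ α P) * H ^ k := mul_nonneg (a.nonneg _) (pow_nonneg hH0 _)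
  linarith

/-- `|P(α) - P(β)| ≤ C H(P) |α - β|` for `P` of degree at most `n` and `β` in the unit ball
around `α`. -/
theorem exists_abs_eval₂_sub_le (φ : R →+* K) (a : AbsoluteValue K ℝ) (α : K) (n : ℕ) :
    ∃ C : ℝ, 0 < C ∧ ∀ P : R[X], P.natDegree ≤ n → ∀ β : K, a (α - β) ≤ 1 →
      ∀ H : ℝ, (∀ i, a (φ (P.coeff i)) ≤ H) →
        a (eval₂ φ α P - eval₂ φ β P) ≤ C * H * a (α - β) := by
  obtain ⟨B, hB⟩ : ∃ B : ℝ, B = a α + 1 := ⟨_, rfl⟩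
  have hα0 := a.nonneg α
  have hB0 : 0 ≤ B := by linarith
  have hS : 0 ≤ ∑ m ∈ Finset.range (n + 1), ∑ i ∈ Finset.range m, B ^ i * B ^ (m - 1 - i) :=
    Finset.sum_nonneg fun _ _ => Finset.sum_nonneg fun _ _ => by positivity
  refine ⟨(∑ m ∈ Finset.range (n + 1), ∑ i ∈ Finset.range m, B ^ i * B ^ (m - 1 - i)) + 1,
    by linarith, fun P hP β hβ H hH => ?_⟩
  have hH0 : 0 ≤ H := (a.nonneg _).trans (hH 0)
  have hβB : a β ≤ B := by
    have := a.sub_le β α 0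
    rw [sub_zero, sub_zero, a.map_sub] at this
    linarith
  rw [eval₂_eq_sum_range' φ (Nat.lt_succ_of_le hP), eval₂_eq_sum_range' φ (Nat.lt_succ_of_le hP),
    ← Finset.sum_sub_distrib]
  have hsum : ∑ m ∈ Finset.range (n + 1),
      H * (a (α - β) * ∑ i ∈ Finset.range m, B ^ i * B ^ (m - 1 - i)) =
      (∑ m ∈ Finset.range (n + 1), ∑ i ∈ Finset.range m, B ^ i * B ^ (m - 1 - i)) * H *
        a (α - β) := by
    rw [Finset.sum_mul, Finset.sum_mul]
    exact Finset.sum_congr rfl fun m _ => by ring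
  have hle : a (∑ m ∈ Finset.range (n + 1),
      (φ (P.coeff m) * α ^ m - φ (P.coeff m) * β ^ m)) ≤ ∑ m ∈ Finset.range (n + 1),
      H * (a (α - β) * ∑ i ∈ Finset.range m, B ^ i * B ^ (m - 1 - i)) := by
    refine (a.sum_le _ _).trans (Finset.sum_le_sum fun m _ => ?_)
    rw [← mul_sub, map_mul, ← (Commute.all α β).mul_geom_sum₂, map_mul]
    refine mul_le_mul (hH m) (mul_le_mul_of_nonneg_left ?_ (a.nonneg _))
      (mul_nonneg (a.nonneg _) (a.nonneg _)) hH0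
    refine (a.sum_le _ _).trans (Finset.sum_le_sum fun i _ => ?_)
    rw [map_mul, map_pow, map_pow]
    exact mul_le_mul (pow_le_pow_left₀ (a.nonneg _) (by linarith) _)
      (pow_le_pow_left₀ (a.nonneg _) hβB _) (pow_nonneg (a.nonneg _) _) (by positivity)
  rw [hsum] at hle
  have : 0 ≤ H * a (α - β) := mul_nonneg hH0 (a.nonneg _)
  nlinarith

/-- Pseudo-division: an annihilating polynomial `Q` of `α` of minimal degree divides every other
one up to a nonzero constant. -/
theorem exists_C_mul_eq_mul_of_eval₂_eq_zero [IsDomain R] (φ : R →+* K) (α : K) {Q : R[X]}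
    (hQ : 0 < Q.natDegree) (hQα : eval₂ φ α Q = 0)
    (hmin : ∀ S : R[X], S ≠ 0 → eval₂ φ α S = 0 → Q.natDegree ≤ S.natDegree)
    (P : R[X]) (hPα : eval₂ φ α P = 0) : ∃ r : R, r ≠ 0 ∧ ∃ S : R[X], C r * P = Q * S := by
  induction hN : P.natDegree using Nat.strong_induction_on generalizing P with
  | _ N ih =>
    subst hN
    by_cases hP : P = 0
    · exact ⟨1, one_ne_zero, 0, by simp [hP]⟩
    have hle := hmin P hP hPα
    obtain ⟨r, hr, S, hS⟩ := ih _
      (natDegree_cancelLeads_lt_of_natDegree_le_natDegree hle (hQ.trans_le hle)) (Q.cancelLeads P)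
      (by simp [cancelLeads, eval₂_mul, hPα, hQα]) rfl
    refine ⟨r * Q.leadingCoeff,
      mul_ne_zero hr (leadingCoeff_ne_zero.2 fun h => by simp [h] at hQ),
      S + C r * (C P.leadingCoeff * X ^ (P.natDegree - Q.natDegree)), ?_⟩
    rw [cancelLeads, Nat.sub_eq_zero_of_le hle, pow_zero, mul_one] at hS
    rw [C_mul]
    linear_combination hS

/-- If an annihilating polynomial `P` of `β` of minimal degree also vanishes at `α`, then every
annihilating polynomial `Q` of `α` of minimal degree vanishes at `β`. -/
theorem eval₂_eq_zero_of_common_root [IsDomain R] (φ : R →+* K)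
    (α β : K) {P Q : R[X]} (hQ : 0 < Q.natDegree) (hQα : eval₂ φ α Q = 0)
    (hmin : ∀ S : R[X], S ≠ 0 → eval₂ φ α S = 0 → Q.natDegree ≤ S.natDegree)
    (hP : P ≠ 0) (hPα : eval₂ φ α P = 0) (hPβ : eval₂ φ β P = 0)
    (hPmin : ∀ S : R[X], S ≠ 0 → eval₂ φ β S = 0 → P.natDegree ≤ S.natDegree) :
    eval₂ φ β Q = 0 := by
  obtain ⟨r, hr, S, hS⟩ := exists_C_mul_eq_mul_of_eval₂_eq_zero φ α hQ hQα hmin P hPα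
  have hQS : Q * S ≠ 0 := hS ▸ mul_ne_zero (C_ne_zero.2 hr) hP
  have hev : eval₂ φ β Q * eval₂ φ β S = 0 := by
    rw [← eval₂_mul, ← hS, eval₂_mul, hPβ, mul_zero]
  refine (mul_eq_zero.1 hev).resolve_right fun hSβ => ?_
  have hdeg : P.natDegree = Q.natDegree + S.natDegree := by
    rw [← natDegree_mul (left_ne_zero_of_mul hQS) (right_ne_zero_of_mul hQS), ← hS,
      natDegree_C_mul hr]
  have := hPmin S (right_ne_zero_of_mul hQS) hSβ
  omega

end Liouville

/-- Polynomials of bounded degree with coefficients in a finite set form a finite set. -/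
theorem finite_setOf_natDegree_le_coeff_mem {R : Type*} [Semiring R] (n : ℕ) {U : Set R}
    (hU : U.Finite) : {P : R[X] | P.natDegree ≤ n ∧ ∀ i, P.coeff i ∈ U}.Finite := by
  let π : R[X] → Fin (n + 1) → R := fun f i => f.coeff i
  refine ((Set.Finite.pi fun _ => hU).subset ?_).of_finite_image (?_ : Set.InjOn π _)
  · exact Set.image_subset_iff.2 fun f hf i _ => hf.2 i
  · exact fun x hx y hy hxy => (ext_iff_natDegree_le hx.1 hy.1).2 fun i hi =>
      congrFun hxy ⟨i, Nat.lt_succ_of_le hi⟩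

/-- If `c * H ^ (-k) ≤ H ^ (-w)` with `H ≥ 1` and `k < w`, then `H` is bounded. -/
theorem le_rpow_of_le_rpow_mul {c H k w : ℝ} (hc : 0 < c) (hH : 1 ≤ H) (hkw : k < w)
    (h : c ≤ H ^ (-w) * H ^ k) : H ≤ c⁻¹ ^ (w - k)⁻¹ := by
  have hH0 : 0 < H := by linarith
  rw [← Real.rpow_add hH0] at h
  have h1 : H ^ (w - k) ≤ c⁻¹ := by
    rw [show w - k = -(-w + k) by ring, Real.rpow_neg hH0.le]
    exact inv_anti₀ hc h
  rwa [Real.le_rpow_inv_iff_of_pos hH0.le (by positivity) (by linarith)]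

namespace CFq

theorem toLS_coeff_neg_natDegree (Fq : Type) [Field Fq] (f : Polynomial Fq) :
    (toLS Fq f).coeff (-(f.natDegree : ℤ)) = f.leadingCoeff := by
  have h : toLS Fq f =
      ∑ i ∈ Finset.range (f.natDegree + 1), HahnSeries.single (-(i : ℤ)) (f.coeff i) := by
    change aeval (Tls Fq) f = _
    rw [aeval_eq_sum_range]
    refine Finset.sum_congr rfl fun i _ => ?_
    rw [Tls, HahnSeries.single_pow, Algebra.smul_def, HahnSeries.algebraMap_apply',
      PowerSeries.algebraMap_apply, HahnSeries.ofPowerSeries_C, HahnSeries.C_apply,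
      HahnSeries.single_mul_single]
    simp
  rw [h, HahnSeries.coeff_sum, Finset.sum_eq_single f.natDegree]
  · rw [HahnSeries.coeff_single_same, leadingCoeff]
  · intro i _ hi
    exact HahnSeries.coeff_single_of_ne (by omega)
  · simp

theorem evalA_algebraMap (Fq : Type) [Field Fq] (L : Type) [Field L]
    [Algebra (LaurentSeries Fq) L] (P : Polynomial (Polynomial Fq)) (ξ : LaurentSeries Fq) :
    evalA Fq L P (algebraMap _ L ξ) = algebraMap _ L (evalLS Fq P ξ) := by
  rw [evalA, evalLS, hom_eval₂, embRing]

variable (Fq : Type) [Field Fq] [Fintype Fq]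

theorem two_le_card : (2 : ℝ) ≤ Fintype.card Fq := by
  exact_mod_cast Fintype.one_lt_card (α := Fq)

theorem two_pow_natDegree_le_pabs {f : Polynomial Fq} (hf : f ≠ 0) :
    (2 : ℝ) ^ f.natDegree ≤ pabs Fq f := by
  have hcoeff : (toLS Fq f).coeff (-(f.natDegree : ℤ)) ≠ 0 := by
    rwa [toLS_coeff_neg_natDegree, leadingCoeff_ne_zero]
  have h0 : toLS Fq f ≠ 0 := fun h => hcoeff (by simp [h])
  have hord := HahnSeries.order_le_of_coeff_ne_zero hcoeff
  have h2 := two_le_card Fq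
  rw [pabs, absQ, if_neg h0]
  calc (2 : ℝ) ^ f.natDegree ≤ (Fintype.card Fq : ℝ) ^ f.natDegree :=
        pow_le_pow_left₀ (by norm_num) h2 _
    _ = (Fintype.card Fq : ℝ) ^ (f.natDegree : ℤ) := (zpow_natCast _ _).symm
    _ ≤ _ := zpow_le_zpow_right₀ (by linarith) (by omega)

theorem one_le_pabs {f : Polynomial Fq} (hf : f ≠ 0) : 1 ≤ pabs Fq f :=
  (one_le_pow₀ (by norm_num)).trans (two_pow_natDegree_le_pabs Fq hf)

theorem toLS_injective : Function.Injective (toLS Fq) := by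
  rw [injective_iff_map_eq_zero]
  intro f hf
  by_contra h0
  have := one_le_pabs Fq h0
  rw [pabs, absQ, if_pos hf] at this
  linarith

theorem pabs_coeff_le_Hpoly (P : Polynomial (Polynomial Fq)) (i : ℕ) :
    pabs Fq (P.coeff i) ≤ Hpoly Fq P := by
  refine le_csSup (Set.Finite.bddAbove ?_) ⟨i, rfl⟩
  refine ((insert 0 P.coeffs).finite_toSet.image (pabs Fq)).subset ?_
  rintro _ ⟨j, rfl⟩
  refine ⟨P.coeff j, ?_, rfl⟩
  by_cases h : P.coeff j = 0
  · simp [h]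
  · simp [coeff_mem_coeffs h]

theorem one_le_Hpoly {P : Polynomial (Polynomial Fq)} (hP : P ≠ 0) : 1 ≤ Hpoly Fq P :=
  (one_le_pabs Fq (leadingCoeff_ne_zero.2 hP)).trans (pabs_coeff_le_Hpoly Fq P _)

theorem finite_setOf_pabs_le (B : ℝ) : {f : Polynomial Fq | pabs Fq f ≤ B}.Finite := by
  obtain ⟨N, hN⟩ := exists_nat_gt B
  refine (finite_setOf_natDegree_le_coeff_mem N (Set.finite_univ (α := Fq))).subset ?_
  intro f hf
  refine ⟨?_, fun _ => Set.mem_univ _⟩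
  by_cases h0 : f = 0
  · simp [h0]
  have h1 : (f.natDegree : ℝ) < 2 ^ f.natDegree := by exact_mod_cast Nat.lt_two_pow_self
  have h2 := two_pow_natDegree_le_pabs Fq h0
  have h3 : pabs Fq f ≤ B := hf
  have : (f.natDegree : ℝ) < N := by linarith
  exact_mod_cast this.le

theorem finite_setOf_Hpoly_le (n : ℕ) (B : ℝ) :
    {P : Polynomial (Polynomial Fq) | P.natDegree ≤ n ∧ Hpoly Fq P ≤ B}.Finite :=
  (finite_setOf_natDegree_le_coeff_mem n (finite_setOf_pabs_le Fq B)).subset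
    fun P hP => ⟨hP.1, fun i => (pabs_coeff_le_Hpoly Fq P i).trans hP.2⟩

variable (L : Type) [Field L] [Algebra (LaurentSeries Fq) L]

theorem embRing_injective : Function.Injective (embRing Fq L) :=
  (algebraMap (LaurentSeries Fq) L).injective.comp (toLS_injective Fq)

theorem finite_setOf_evalA_eq_zero {S : Set (Polynomial (Polynomial Fq))} (hS : S.Finite) :
    {β : L | ∃ P ∈ S, P ≠ 0 ∧ evalA Fq L P β = 0}.Finite := by
  refine (hS.biUnion fun P _ => (P.map (embRing Fq L)).roots.toFinset.finite_toSet).subset ?_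
  rintro β ⟨P, hPS, hP, hβ⟩
  have h0 : P.map (embRing Fq L) ≠ 0 := by
    rwa [Ne, Polynomial.map_eq_zero_iff (embRing_injective Fq L)]
  simp only [Set.mem_iUnion]
  refine ⟨P, hPS, ?_⟩
  rw [Finset.mem_coe, Multiset.mem_toFinset, mem_roots h0, IsRoot.def, eval_map]
  exact hβ

/-- The height of an algebraic element is approximated, up to a factor `2`, by the height of
one of its annihilating polynomials of minimal degree. -/
theorem exists_Hpoly_lt_two_mul_heightA {n : ℕ} {β : L} (hβ : IsAlgDeg Fq L n β) :
    1 ≤ heightA Fq L β ∧ ∃ P : Polynomial (Polynomial Fq), P ≠ 0 ∧ P.natDegree ≤ n ∧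
      evalA Fq L P β = 0 ∧ Hpoly Fq P < 2 * heightA Fq L β ∧
      ∀ S : Polynomial (Polynomial Fq), S ≠ 0 → evalA Fq L S β = 0 →
        P.natDegree ≤ S.natDegree := by
  obtain ⟨P₀, h0, hn, he⟩ := hβ
  have hmem := Nat.sInf_mem (s := {d | ∃ P : Polynomial (Polynomial Fq),
    P ≠ 0 ∧ P.natDegree = d ∧ evalA Fq L P β = 0}) ⟨_, P₀, h0, rfl, he⟩
  have hle : degA Fq L β ≤ P₀.natDegree := Nat.sInf_le ⟨P₀, h0, rfl, he⟩
  obtain ⟨P₁, h1, hd1, he1⟩ := hmem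
  have hne : {x | ∃ P : Polynomial (Polynomial Fq), P ≠ 0 ∧ P.natDegree = degA Fq L β ∧
      evalA Fq L P β = 0 ∧ x = Hpoly Fq P}.Nonempty := ⟨_, P₁, h1, hd1, he1, rfl⟩
  have hone : 1 ≤ heightA Fq L β := by
    refine le_csInf hne ?_
    rintro _ ⟨P, hP, -, -, rfl⟩
    exact one_le_Hpoly Fq hP
  refine ⟨hone, ?_⟩
  obtain ⟨_, ⟨P, hP, hd, he, rfl⟩, hlt⟩ :=
    exists_lt_of_csInf_lt (b := 2 * heightA Fq L β) hne
      (show heightA Fq L β < 2 * heightA Fq L β by linarith)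
  exact ⟨P, hP, (hd.trans_le hle).trans hn, he, hlt, fun S hS hSβ =>
    hd.trans_le (Nat.sInf_le ⟨S, hS, rfl, hSβ⟩)⟩

theorem exists_degLS_eq_add_one {α : LaurentSeries Fq}
    (halg : ∃ P : Polynomial (Polynomial Fq), P ≠ 0 ∧ evalLS Fq P α = 0) :
    ∃ k, degLS Fq α = k + 1 ∧
      (∃ Q : Polynomial (Polynomial Fq), Q.natDegree = k + 1 ∧ evalLS Fq Q α = 0) ∧
      ∀ P : Polynomial (Polynomial Fq), P ≠ 0 → evalLS Fq P α = 0 → k + 1 ≤ P.natDegree := by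
  obtain ⟨P, hP, hPα⟩ := halg
  obtain ⟨Q, hQ, hd, hQα⟩ := Nat.sInf_mem (s := {d | ∃ P : Polynomial (Polynomial Fq),
    P ≠ 0 ∧ P.natDegree = d ∧ evalLS Fq P α = 0}) ⟨_, P, hP, rfl, hPα⟩
  change Q.natDegree = degLS Fq α at hd
  have hpos : degLS Fq α ≠ 0 := by
    intro h
    rw [h] at hd
    rw [eq_C_of_natDegree_eq_zero hd] at hQ hQα
    rw [evalLS, eval₂_C, map_eq_zero_iff _ (toLS_injective Fq)] at hQα
    exact hQ (by rw [hQα, C_0])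
  obtain ⟨k, hk⟩ := Nat.exists_eq_add_one_of_ne_zero hpos
  refine ⟨k, hk, ⟨Q, hd.trans hk, hQα⟩, fun P hP hPα => ?_⟩
  rw [← hk]
  exact Nat.sInf_le ⟨P, hP, rfl, hPα⟩

section Bounds

variable {Fq L}

theorem exists_liouville_bound_evalA {v : AbsoluteValue L ℝ}
    (hv : ∀ x : LaurentSeries Fq, v (algebraMap (LaurentSeries Fq) L x) = absQ Fq x)
    (n k : ℕ) {α : LaurentSeries Fq}
    (hQ : ∃ Q : Polynomial (Polynomial Fq), Q.natDegree = k + 1 ∧ evalLS Fq Q α = 0)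
    (hmin : ∀ P : Polynomial (Polynomial Fq), P ≠ 0 → evalLS Fq P α = 0 → k + 1 ≤ P.natDegree) :
    ∃ c : ℝ, 0 < c ∧ ∀ P : Polynomial (Polynomial Fq), P.natDegree ≤ n →
      evalA Fq L P (algebraMap _ L α) ≠ 0 →
      c ≤ v (evalA Fq L P (algebraMap _ L α)) * Hpoly Fq P ^ k := by
  obtain ⟨Q, hd, hQα⟩ := hQ
  obtain ⟨c, hc, h⟩ := exists_liouville_bound (embRing Fq L) v
    (fun r hr => (one_le_pabs Fq hr).trans_eq (hv _).symm) (algebraMap _ L α) k n Q hd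
    (by rw [← evalA, evalA_algebraMap, hQα, map_zero])
    (fun P hP hPα => hmin P hP <| by
      rwa [← evalA, evalA_algebraMap, map_eq_zero] at hPα)
  exact ⟨c, hc, fun P hP hPα => h P hP hPα _ fun i =>
    (hv _).trans_le (pabs_coeff_le_Hpoly Fq P i)⟩

theorem wExp_le_of_liouville {v : AbsoluteValue L ℝ}
    (hv : ∀ x : LaurentSeries Fq, v (algebraMap (LaurentSeries Fq) L x) = absQ Fq x)
    (n k : ℕ) {α : LaurentSeries Fq}
    (hQ : ∃ Q : Polynomial (Polynomial Fq), Q.natDegree = k + 1 ∧ evalLS Fq Q α = 0)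
    (hmin : ∀ P : Polynomial (Polynomial Fq), P ≠ 0 → evalLS Fq P α = 0 → k + 1 ≤ P.natDegree) :
    wExp Fq n α ≤ ((k : ℝ) : EReal) := by
  obtain ⟨c, hc, hbound⟩ := exists_liouville_bound_evalA hv n k hQ hmin
  refine sSup_le ?_
  rintro _ ⟨w, hw, rfl⟩
  refine EReal.coe_le_coe_iff.2 ?_
  by_contra! hkw
  refine hw ((finite_setOf_Hpoly_le Fq n (c⁻¹ ^ (w - k)⁻¹)).subset ?_)
  rintro P ⟨hPn, hpos, hle⟩
  have hP0 : P ≠ 0 := by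
    rintro rfl
    simp [evalLS, absQ] at hpos
  have hH := one_le_Hpoly Fq hP0
  have hev : v (evalA Fq L P (algebraMap _ L α)) = absQ Fq (evalLS Fq P α) := by
    rw [evalA_algebraMap, hv]
  have hne : evalA Fq L P (algebraMap _ L α) ≠ 0 := by
    rw [← v.pos_iff, hev]
    exact hpos
  refine ⟨hPn, le_rpow_of_le_rpow_mul hc hH hkw ?_⟩
  rw [Real.rpow_natCast]
  refine (hbound P hPn hne).trans (mul_le_mul_of_nonneg_right ?_ (by positivity))
  rw [hev]
  exact hle

theorem wstarExp_le_of_liouville {v : AbsoluteValue L ℝ}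
    (hv : ∀ x : LaurentSeries Fq, v (algebraMap (LaurentSeries Fq) L x) = absQ Fq x)
    (n k : ℕ) {α : LaurentSeries Fq}
    (hQ : ∃ Q : Polynomial (Polynomial Fq), Q.natDegree = k + 1 ∧ evalLS Fq Q α = 0)
    (hmin : ∀ P : Polynomial (Polynomial Fq), P ≠ 0 → evalLS Fq P α = 0 → k + 1 ≤ P.natDegree) :
    wstarExp Fq L n α v ≤ ((k : ℝ) : EReal) := by
  obtain ⟨c, hc, hbound⟩ := exists_liouville_bound_evalA hv n k hQ hmin
  obtain ⟨C, hC, hlip⟩ := exists_abs_eval₂_sub_le (embRing Fq L) v (algebraMap _ L α) n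
  obtain ⟨Q, hd, hQα⟩ := hQ
  have hQ0 : Q ≠ 0 := fun h => by simp [h] at hd
  refine sSup_le ?_
  rintro _ ⟨w, hw, rfl⟩
  refine EReal.coe_le_coe_iff.2 ?_
  by_contra! hkw
  have hk0 : (0 : ℝ) ≤ k := Nat.cast_nonneg k
  obtain ⟨c', hc'⟩ : ∃ c' : ℝ, c' = c / (C * 2 * 2 ^ k) := ⟨_, rfl⟩
  have hc'0 : 0 < c' := by rw [hc']; positivity
  set B : ℝ := c'⁻¹ ^ (w - k)⁻¹
  refine hw (((finite_setOf_evalA_eq_zero Fq L (finite_setOf_Hpoly_le Fq n (2 * B))).union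
    (finite_setOf_evalA_eq_zero Fq L (Set.finite_singleton Q))).subset ?_)
  rintro β ⟨hβ, hpos, hle⟩
  obtain ⟨hh, P, hP0, hPn, hPβ, hHP, hPmin⟩ := exists_Hpoly_lt_two_mul_heightA Fq L hβ
  set h := heightA Fq L β
  by_cases hPα : evalA Fq L P (algebraMap _ L α) = 0
  · refine Or.inr ⟨Q, rfl, hQ0, ?_⟩
    refine eval₂_eq_zero_of_common_root (embRing Fq L) (algebraMap _ L α) β (by omega) (by rw [← evalA, evalA_algebraMap, hQα, map_zero])
      (fun S hS hSα => ?_) hP0 hPα hPβ hPmin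
    rw [hd]
    refine hmin S hS ?_
    rwa [← evalA, evalA_algebraMap, map_eq_zero] at hSα
  · refine Or.inl ⟨P, ⟨hPn, ?_⟩, hP0, hPβ⟩
    have hh0 : 0 < h := by linarith
    have hH1 := one_le_Hpoly Fq hP0
    have hdist : v (algebraMap _ L α - β) ≤ 1 :=
      hle.trans (Real.rpow_le_one_of_one_le_of_nonpos hh (by linarith))
    have h1 := hlip P hPn β hdist (Hpoly Fq P) fun i =>
      (hv _).trans_le (pabs_coeff_le_Hpoly Fq P i)
    rw [← evalA, ← evalA, hPβ, sub_zero] at h1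
    have h2 : v (evalA Fq L P (algebraMap _ L α)) ≤ C * 2 * h ^ (-w) := by
      calc _ ≤ C * Hpoly Fq P * v (algebraMap _ L α - β) := h1
        _ ≤ C * (2 * h) * h ^ (-w - 1) := by gcongr
        _ = C * 2 * (h * h ^ (-w - 1)) := by ring
        _ = C * 2 * h ^ (-w) := by
          rw [Real.rpow_sub_one hh0.ne', mul_div_cancel₀ _ hh0.ne']
    have h3 : c ≤ C * 2 * h ^ (-w) * (2 * h) ^ k :=
      (hbound P hPn hPα).trans (by gcongr)
    have h4 : c' ≤ h ^ (-w) * h ^ (k : ℝ) := by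
      rw [hc', div_le_iff₀ (by positivity), Real.rpow_natCast]
      refine h3.trans_eq ?_
      rw [mul_pow]
      ring
    have h5 := le_rpow_of_le_rpow_mul hc'0 hh hkw h4
    linarith

end Bounds

end CFq

/-- for algebraic `α`, `w_n(α) ≤ deg α − 1` and `w_n^*(α) ≤ deg α − 1`. -/
theorem stmt8 (Fq : Type) [Field Fq] [Fintype Fq]
    (L : Type) [Field L] [Algebra (LaurentSeries Fq) L] [IsAlgClosed L]
    (v : AbsoluteValue L ℝ)
    (hv : ∀ x : LaurentSeries Fq, v (algebraMap (LaurentSeries Fq) L x) = CFq.absQ Fq x)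
    (n : ℕ) (hn : 1 ≤ n) (α : LaurentSeries Fq)
    (halg : ∃ P : Polynomial (Polynomial Fq), P ≠ 0 ∧ CFq.evalLS Fq P α = 0) :
    CFq.wstarExp Fq L n α v ≤ (CFq.degLS Fq α : EReal) - 1 ∧
      CFq.wExp Fq n α ≤ (CFq.degLS Fq α : EReal) - 1 := by
  obtain ⟨k, hk, hQ, hmin⟩ := CFq.exists_degLS_eq_add_one Fq halg
  have hcast : ((CFq.degLS Fq α : EReal) - 1) = ((k : ℝ) : EReal) := by
    rw [hk, show ((k + 1 : ℕ) : EReal) = (((k : ℝ) + 1 : ℝ) : EReal) by norm_cast,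
      ← EReal.coe_one, ← EReal.coe_sub, add_sub_cancel_right]
  rw [hcast]
  exact ⟨CFq.wstarExp_le_of_liouville hv n k hQ hmin, CFq.wExp_le_of_liouville hv n k hQ hmin⟩
end
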